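/- Let T = ℤ^17 with Gram matrix G the orthogonal block sum of U, U, E_8 and five copies of A_1; let e,f be the standard basis of the first U block and r_1,…,r_5 the basis vectors of the five A_1 blocks. Let Δ = {r ∈ ℤ^17 : rᵀGr = -2} and O(T) = {P ∈ GL(17,ℤ) : PᵀGP = G}. Then every r ∈ Δ lies in the O(T)-orbit of exactly one of the three vectors: e - f, r_1, and 2(e+f) + r_1 + r_2 + r_3 + r_4 + r_5; i.e. O(T) has exactly three orbits on Δ, namely Δ_1 = {r ∈ Δ : Gr ∉ 2ℤ^17}, Δ_2 = {r ∈ Δ : Gr ∈ 2ℤ^17 and the class of r/2 in T*/T is the class of (r_1+⋯+r_5)/2}, and Δ_3 = {r ∈ Δ : Gr ∈ 2ℤ^17 and the class of r/2 in T*/T is the class of r_i/2 for some i}. -/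

import Mathlib

open Matrix

/-- Gram matrix of the hyperbolic plane `U`. -/
def gramU : Matrix (Fin 2) (Fin 2) ℤ := !![0, 1; 1, 0]

/-- Gram matrix of the negative definite root lattice whose Dynkin diagram is a chain
on nodes `0, …, n-2` together with an extra node `n-1` attached to node `k`;
for `E₈` the chain has 7 nodes and the extra node is attached to node `2`. -/
def gramRoot (n k : ℕ) : Matrix (Fin n) (Fin n) ℤ :=
  Matrix.of fun i j =>
    if i = j then -2
    else if (((i : ℕ) + 1 = j ∨ (j : ℕ) + 1 = i) ∧ (i : ℕ) + 1 ≠ n ∧ (j : ℕ) + 1 ≠ n) ∨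
        ((i : ℕ) + 1 = n ∧ (j : ℕ) = k) ∨ ((j : ℕ) + 1 = n ∧ (i : ℕ) = k) then 1
    else 0

/-- Gram matrix of the standard negative definite root lattice `E₈`. -/
def gramE8 : Matrix (Fin 8) (Fin 8) ℤ := gramRoot 8 2

/-- Orthogonal (block diagonal) sum of two Gram matrices. -/
def blockSum {m n : ℕ} (A : Matrix (Fin m) (Fin m) ℤ) (B : Matrix (Fin n) (Fin n) ℤ) :
    Matrix (Fin (m + n)) (Fin (m + n)) ℤ :=
  Matrix.of fun i j =>
    if hi : (i : ℕ) < m then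
      if hj : (j : ℕ) < m then A ⟨i, hi⟩ ⟨j, hj⟩ else 0
    else
      if hj : (j : ℕ) < m then 0
      else B ⟨(i : ℕ) - m, by have := i.isLt; omega⟩ ⟨(j : ℕ) - m, by have := j.isLt; omega⟩

/-- Gram matrix of `T = U ⊕ U ⊕ E₈ ⊕ A₁⁵` (coordinates: `e, f` at indices 0,1;
the second copy of `U` at indices 2,3; `E₈` at indices 4–11; `r₁, …, r₅` at indices 12–16). -/
def gramT : Matrix (Fin 17) (Fin 17) ℤ :=
  blockSum gramU (blockSum gramU (blockSum gramE8 (Matrix.diagonal fun _ : Fin 5 => (-2 : ℤ))))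

/-- `P` is an isometry of the lattice `(ℤⁿ, G)`, i.e. `P ∈ GL(n, ℤ)` with `Pᵀ G P = G`. -/
def IsIsometry {n : ℕ} (G P : Matrix (Fin n) (Fin n) ℤ) : Prop :=
  IsUnit P.det ∧ Pᵀ * G * P = G

/-- The basis vector `e` of the first copy of `U` in `T`. -/
def eU : Fin 17 → ℤ := Pi.single 0 1

/-- The basis vector `f` of the first copy of `U` in `T`. -/
def fU : Fin 17 → ℤ := Pi.single 1 1

/-- The basis vectors `r₁, …, r₅` of the five copies of `A₁` in `T`. -/
def rA (k : Fin 5) : Fin 17 → ℤ := Pi.single ⟨12 + (k : ℕ), by have := k.isLt; omega⟩ 1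

/-- `r` and `r'` lie in the same `O(T)`-orbit. -/
def OrbEquiv (v r : Fin 17 → ℤ) : Prop :=
  ∃ P : Matrix (Fin 17) (Fin 17) ℤ, IsIsometry gramT P ∧ P.mulVec v = r

/-- The three orbit representatives `e - f`, `r₁`, `2(e+f) + r₁ + ⋯ + r₅`. -/
def reps : Fin 3 → (Fin 17 → ℤ) :=
  ![eU - fU, rA 0, 2 • (eU + fU) + ∑ k : Fin 5, rA k]

section Eichler
variable {V : Type*} [AddCommGroup V]

/-- isometry relation -/
def IsoRel (B : V → V → ℤ) (v w : V) : Prop :=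
  ∃ f : V ≃ₗ[ℤ] V, (∀ x y, B (f x) (f y) = B x y) ∧ f v = w

/-- isometry relation preserving the class modulo 2 when the divisor is even -/
def ERel (B : V → V → ℤ) (v w : V) : Prop :=
  ∃ f : V ≃ₗ[ℤ] V, (∀ x y, B (f x) (f y) = B x y) ∧ f v = w ∧
    ((∀ y, (2 : ℤ) ∣ B v y) → ∃ z, w - v = (2 : ℤ) • z)

/-- an even symmetric bilinear form -/
structure EvenForm (B : V → V → ℤ) (q : V → ℤ) : Prop where
  symm : ∀ x y, B x y = B y x
  add : ∀ x y z, B x (y + z) = B x y + B x z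
  smul : ∀ x (n : ℤ) y, B x (n • y) = n * B x y
  even : ∀ x, B x x = 2 * q x

variable {B : V → V → ℤ} {q : V → ℤ}

theorem EvenForm.add' (h : EvenForm B q) (x y z : V) : B (x + y) z = B x z + B y z := by
  rw [h.symm, h.add, h.symm z x, h.symm z y]

theorem EvenForm.smul' (h : EvenForm B q) (n : ℤ) (x y : V) : B (n • x) y = n * B x y := by
  rw [h.symm, h.smul, h.symm]

theorem EvenForm.sub (h : EvenForm B q) (x y z : V) : B x (y - z) = B x y - B x z := by
  have := h.add x (y - z) z
  rw [sub_add_cancel] at this; omega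

theorem EvenForm.q_neg (h : EvenForm B q) (x : V) : q (-x) = q x := by
  have h1 := h.even (-x)
  rw [← neg_one_zsmul, h.smul, h.smul', h.even] at h1
  rw [← neg_one_zsmul]
  omega

/-- Eichler transvection, as a map -/
def eich (B : V → V → ℤ) (q : V → ℤ) (e u x : V) : V :=
  x + (B e x) • u + (-(B u x) - q u * B e x) • e

theorem eich_pair (h : EvenForm B q) (e u x y : V) :
    B y (eich B q e u x) = B y x + B e x * B y u + (-(B u x) - q u * B e x) * B y e := by
  simp only [eich, h.add, h.smul]

theorem eich_inv (h : EvenForm B q) (e u x : V) (he : B e e = 0) (hu : B e u = 0) :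
    eich B q e (-u) (eich B q e u x) = x := by
  have hn : ∀ y, B (-u) y = - B u y := fun y => by
    rw [← neg_one_zsmul, h.smul']; ring
  have hu' : B u e = 0 := by rw [h.symm]; exact hu
  simp only [eich, hn, h.q_neg, h.add, h.smul, he, hu, hu', h.even]
  module

/-- Eichler transvection, as a linear equivalence -/
def eichE (h : EvenForm B q) (e u : V) (he : B e e = 0) (hu : B e u = 0) : V ≃ₗ[ℤ] V where
  toFun := eich B q e u
  invFun := eich B q e (-u)
  left_inv x := eich_inv h e u x he hu
  right_inv x := by
    have := eich_inv h e (-u) x he (by rw [← neg_one_zsmul, h.smul, hu, mul_zero])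
    rwa [neg_neg] at this
  map_add' x y := by simp only [eich, h.add]; module
  map_smul' n x := by simp only [eich, h.smul, RingHom.id_apply]; module

theorem eich_rel (h : EvenForm B q) (e u : V) (he : B e e = 0) (hu : B e u = 0) (x : V) :
    ERel B x (eich B q e u x) := by
  refine ⟨eichE h e u he hu, fun x y => ?_, rfl, fun hx => ?_⟩
  · change B (eich B q e u x) (eich B q e u y) = B x y
    have hu' : B u e = 0 := by rw [h.symm]; exact hu
    rw [eich_pair h, h.symm _ y, h.symm _ u, h.symm _ e, eich_pair h, eich_pair h, eich_pair h,
      he, hu, hu', h.even, h.symm y x, h.symm y u, h.symm y e]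
    ring
  · obtain ⟨a, ha⟩ := hx e
    obtain ⟨b, hb⟩ := hx u
    rw [h.symm] at ha hb
    refine ⟨a • u + (-b - q u * a) • e, ?_⟩
    unfold eich
    rw [ha, hb]
    module

theorem ERel.refl (v : V) : ERel B v v :=
  ⟨LinearEquiv.refl ℤ V, fun _ _ => rfl, rfl, fun _ => ⟨0, by simp⟩⟩

theorem iso_dvd {v w : V} {f : V ≃ₗ[ℤ] V} (hf : ∀ x y, B (f x) (f y) = B x y) (hv : f v = w)
    (n : ℤ) : (∀ y, n ∣ B w y) ↔ (∀ y, n ∣ B v y) := by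
  subst hv
  refine ⟨fun H y => ?_, fun H y => ?_⟩
  · rw [← hf]; exact H _
  · have := H (f.symm y)
    rw [← hf] at this; simpa using this

theorem ERel.trans {u v w : V} (h1 : ERel B u v) (h2 : ERel B v w) : ERel B u w := by
  obtain ⟨f, hf, hu, hu2⟩ := h1
  obtain ⟨g, hg, hv, hv2⟩ := h2
  refine ⟨f.trans g, fun x y => by simp [hf, hg], by simp [hu, hv], fun H => ?_⟩
  obtain ⟨z, hz⟩ := hu2 H
  obtain ⟨z', hz'⟩ := hv2 ((iso_dvd hf hu 2).2 H)
  refine ⟨z + z', ?_⟩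
  rw [smul_add, ← hz, ← hz']; abel

theorem ERel.iso {v w : V} (h : ERel B v w) : IsoRel B v w := by
  obtain ⟨f, hf, hu, _⟩ := h
  exact ⟨f, hf, hu⟩

theorem IsoRel.trans {u v w : V} (h1 : IsoRel B u v) (h2 : IsoRel B v w) : IsoRel B u w := by
  obtain ⟨f, hf, hu⟩ := h1
  obtain ⟨g, hg, hv⟩ := h2
  exact ⟨f.trans g, fun x y => by simp [hf, hg], by simp [hu, hv]⟩

theorem IsoRel.symm {u v : V} (h1 : IsoRel B u v) : IsoRel B v u := by
  obtain ⟨f, hf, hu⟩ := h1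
  exact ⟨f.symm, fun x y => by rw [← hf]; simp, by simp [← hu]⟩

/-- two orthogonal hyperbolic planes -/
structure TwoHyp (B : V → V → ℤ) (e f e1 f1 : V) : Prop where
  ee : B e e = 0
  ff : B f f = 0
  e1e1 : B e1 e1 = 0
  f1f1 : B f1 f1 = 0
  ef : B e f = 1
  e1f1 : B e1 f1 = 1
  ee1 : B e e1 = 0
  ef1 : B e f1 = 0
  fe1 : B f e1 = 0
  ff1 : B f f1 = 0

theorem TwoHyp.swap {e f e1 f1 : V} (h : EvenForm B q) (H : TwoHyp B e f e1 f1) :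
    TwoHyp B e f f1 e1 :=
  ⟨H.ee, H.ff, H.f1f1, H.e1e1, H.ef, by rw [h.symm]; exact H.e1f1, H.ef1, H.ee1, H.ff1, H.fe1⟩

/-- the moves between coordinates in the two hyperbolic planes -/
theorem q_iso (h : EvenForm B q) (x : V) (hx : B x x = 0) (n : ℤ) : q (n • x) = 0 := by
  have h1 := h.even (n • x)
  rw [h.smul, h.smul', hx] at h1
  omega

theorem exists_pos (h : EvenForm B q) {e f e1 f1 : V} (H : TwoHyp B e f e1 f1) (w : V)
    (hw : B e1 w ≠ 0) : ∃ w', ERel B w w' ∧ 0 < B f w' := by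
  refine ⟨_, eich_rel h e ((-(B e1 w) * (|B f w| + 1)) • e1) H.ee
    (by rw [h.smul, H.ee1, mul_zero]) w, ?_⟩
  rw [eich_pair h, h.smul, H.fe1, q_iso h _ H.e1e1, h.symm f e, H.ef, h.smul']
  have : 1 ≤ B e1 w * B e1 w := by
    have := mul_self_pos.2 hw
    omega
  have h2 := neg_abs_le (B f w)
  have h3 := abs_nonneg (B f w)
  nlinarith

theorem exists_pos' (h : EvenForm B q) {e f e1 f1 : V} (H : TwoHyp B e f e1 f1) (v : V)
    (hv : B v v ≠ 0) : ∃ w, ERel B v w ∧ 0 < B f w := by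
  suffices ∃ w, ERel B v w ∧ (B e1 w ≠ 0 ∨ B f1 w ≠ 0) by
    obtain ⟨w, h1, h2 | h2⟩ := this
    · obtain ⟨w', h3, h4⟩ := exists_pos h H w h2
      exact ⟨w', h1.trans h3, h4⟩
    · obtain ⟨w', h3, h4⟩ := exists_pos h (H.swap h) w h2
      exact ⟨w', h1.trans h3, h4⟩
  by_contra! hc
  obtain ⟨hp, hs⟩ := hc v (ERel.refl v)
  have h3 := (hc _ (eich_rel h e1 v H.e1e1 hp v)).2
  rw [eich_pair h, hp, hs, h.symm f1, H.e1f1] at h3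
  apply hv
  linarith

theorem min_dvd_p (h : EvenForm B q) {e f e1 f1 : V} (H : TwoHyp B e f e1 f1) (v : V) (a : ℤ)
    (ha : 0 < a) (hmin : ∀ w, ERel B v w → 0 < B f w → a ≤ B f w) (w : V) (hw : ERel B v w)
    (hwa : B f w = a) : a ∣ B e1 w := by
  -- reduce modulo `a`
  have r1 := eich_rel h f ((-(B e1 w / a)) • f1) H.ff (by rw [h.smul, H.ff1, mul_zero]) w
  set w1 := eich B q f ((-(B e1 w / a)) • f1) w with hw1
  have hp1 : B e1 w1 = B e1 w % a := by
    rw [hw1, eich_pair h, h.smul, H.e1f1, q_iso h _ H.f1f1, h.symm e1 f, H.fe1, hwa, Int.emod_def]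
    ring
  have ha1 : B f w1 = a := by
    rw [hw1, eich_pair h, h.smul, H.ff1, q_iso h _ H.f1f1, H.ff, hwa]
    ring
  have r2 := eich_rel h e e1 H.ee H.ee1 w1
  have q1 : q e1 = 0 := by simpa using q_iso h _ H.e1e1 1
  have ha2 : B f (eich B q e e1 w1) = a - B e1 w % a := by
    rw [eich_pair h, H.fe1, q1, h.symm f e, H.ef, ha1, hp1]
    ring
  have l1 := Int.emod_lt_of_pos (B e1 w) ha
  have l2 := Int.emod_nonneg (B e1 w) ha.ne'
  have := hmin _ ((hw.trans r1).trans r2) (by rw [ha2]; omega)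
  rw [ha2] at this
  apply Int.dvd_of_emod_eq_zero
  omega

theorem min_dvd (h : EvenForm B q) {e f e1 f1 : V} (H : TwoHyp B e f e1 f1) (v : V) (a : ℤ)
    (ha : 0 < a) (hmin : ∀ w, ERel B v w → 0 < B f w → a ≤ B f w) (w : V) (hw : ERel B v w)
    (hwa : B f w = a) (y : V) : a ∣ B y w := by
  have P := min_dvd_p h H v a ha hmin
  have S := min_dvd_p h (H.swap h) v a ha hmin
  have hp := P w hw hwa
  have hs := S w hw hwa
  have hf1e1 : B f1 e1 = 1 := by rw [h.symm]; exact H.e1f1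
  -- pairing with vectors orthogonal to `f` and `e1`
  have Y : ∀ y, B f y = 0 → B e1 y = 0 → a ∣ B y w := by
    intro y hy1 hy2
    have r := eich_rel h e1 y H.e1e1 hy2 w
    have := S _ (hw.trans r) (by rw [eich_pair h, hy1, H.fe1, hwa]; ring)
    rw [eich_pair h, hf1e1] at this
    have h2 : B y w = B f1 w + B e1 w * (B f1 y - q y) -
        (B f1 w + B e1 w * B f1 y + (-B y w - q y * B e1 w) * 1) := by ring
    rw [h2]
    exact dvd_sub (dvd_add hs (hp.mul_right _)) this
  -- pairing with `e`
  have E : a ∣ B e w := by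
    obtain ⟨k, hk⟩ := hs
    have r1 := eich_rel h f ((-k) • e1) H.ff (by rw [h.smul, H.fe1, mul_zero]) w
    set w1 := eich B q f ((-k) • e1) w with hw1
    have hs1 : B f1 w1 = 0 := by
      rw [hw1, eich_pair h, h.smul, hf1e1, q_iso h _ H.e1e1, h.symm f1 f, H.ff1, hwa, hk]
      ring
    have ha1 : B f w1 = a := by
      rw [hw1, eich_pair h, h.smul, H.fe1, q_iso h _ H.e1e1, H.ff, hwa]
      ring
    have hb1 : B e w1 = B e w + k * B e1 w := by
      rw [hw1, eich_pair h, h.smul, h.smul', H.ee1, q_iso h _ H.e1e1, H.ef]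
      ring
    have hp1 : B e1 w1 = B e1 w := by
      rw [hw1, eich_pair h, h.smul, H.e1e1, h.symm e1 f, H.fe1]
      ring
    have r2 := eich_rel h e f1 H.ee H.ef1 w1
    have q1 : q f1 = 0 := by simpa using q_iso h _ H.f1f1 1
    have := P _ ((hw.trans r1).trans r2) (by
      rw [eich_pair h, H.ff1, q1, hs1, ha1]; ring)
    rw [eich_pair h, H.e1f1, h.symm e1 e, H.ee1, hb1, hp1] at this
    have h2 : B e w = (B e1 w + (B e w + k * B e1 w) * 1 +
      (-B f1 w1 - q f1 * (B e w + k * B e1 w)) * 0) - B e1 w * (1 + k) := by ring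
    rw [h2]
    exact dvd_sub this (hp.mul_right _)
  have := Y (y - B f y • e - B e1 y • f1)
    (by rw [h.sub, h.sub, h.smul, h.smul, h.symm f e, H.ef, H.ff1]; ring)
    (by rw [h.sub, h.sub, h.smul, h.smul, h.symm e1 e, H.ee1, H.e1f1]; ring)
  rw [h.symm, h.sub, h.sub, h.smul, h.smul, h.symm w y, h.symm w e, h.symm w f1] at this
  have h2 : B y w = (B y w - B f y * B e w - B e1 y * B f1 w) + B f y * B e w
    + B e1 y * B f1 w := by ring
  rw [h2]
  exact dvd_add (dvd_add this (E.mul_left _)) (hs.mul_left _)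

/-- every vector can be moved so that its `e`-coordinate is its divisor -/
theorem exists_min (h : EvenForm B q) {e f e1 f1 : V} (H : TwoHyp B e f e1 f1) (v : V)
    (hv : B v v ≠ 0) : ∃ w, ERel B v w ∧ 0 < B f w ∧ ∀ y, B f w ∣ B y w := by
  classical
  have hex : ∃ n : ℕ, 0 < n ∧ ∃ w, ERel B v w ∧ B f w = n := by
    obtain ⟨w, h1, h2⟩ := exists_pos' h H v hv
    exact ⟨(B f w).toNat, by omega, w, h1, by omega⟩
  obtain ⟨hn, w, hw, hwn⟩ := Nat.find_spec hex
  refine ⟨w, hw, by omega, ?_⟩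
  refine min_dvd h H v (B f w) (by omega) (fun w' hw' hp => ?_) w hw rfl
  have := Nat.find_min' hex (m := (B f w').toNat) ⟨by omega, w', hw', by omega⟩
  omega

theorem same_class (h : EvenForm B q) {f : V} (hff : B f f = 0) (w w' z : V) (ha : B f w ≠ 0)
    (hz : w' = w + (B f w) • z) (haa : B f w' = B f w) (hq : B w w = B w' w') :
    ERel B w w' := by
  have hfz : B f z = 0 := by
    have := haa
    rw [hz, h.add, h.smul] at this
    have h2 : B f w * B f z = 0 := by linarith
    exact (mul_eq_zero.1 h2).resolve_left ha
  have r := eich_rel h f z hff hfz w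
  set k := -(B z w) - q z * B f w with hk
  have hE : eich B q f z w = w' + k • f := by rw [hz, hk]; rfl
  rw [hE] at r
  obtain ⟨g, hg, hgw, _⟩ := id r
  have h3 : B (w' + k • f) (w' + k • f) = B w w := by rw [← hgw, hg]
  rw [h.add, h.smul, h.add', h.smul', h.add', h.smul', h.symm w' f, hff, haa, hq] at h3
  have h4 : k * B f w = 0 := by linarith
  have h5 : k = 0 := (mul_eq_zero.1 h4).resolve_right ha
  rwa [h5, zero_smul, add_zero] at r

theorem eichler_root (h : EvenForm B q) {e f e1 f1 : V} (H : TwoHyp B e f e1 f1) (v v' : V)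
    (hv : B v v = -2) (hv' : B v' v' = -2)
    (hd : (∃ y, ¬ 2 ∣ B v y) ∧ (∃ y, ¬ 2 ∣ B v' y) ∨
      (∀ y, 2 ∣ B v y) ∧ (∀ y, 2 ∣ B v' y) ∧ ∃ z, v' - v = (2 : ℤ) • z) :
    IsoRel B v v' := by
  obtain ⟨w, hw, hp, hdiv⟩ := exists_min h H v (by omega)
  obtain ⟨w', hw', hp', hdiv'⟩ := exists_min h H v' (by omega)
  have key : ∀ v w, B v v = -2 → ERel B v w → 0 < B f w → (∀ y, B f w ∣ B y w) → B w w = -2 ∧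
      ((∃ y, ¬ 2 ∣ B v y) → B f w = 1) ∧ ((∀ y, 2 ∣ B v y) → B f w = 2) := by
    rintro v w hv ⟨g, hg, hgv, _⟩ hp hdiv
    have hww : B w w = -2 := by rw [← hgv, hg, hv]
    have h2 : B f w ∣ 2 := by
      have := hdiv w
      rw [hww] at this
      simpa using this
    have h12 : B f w = 1 ∨ B f w = 2 := by
      have := Int.le_of_dvd (by norm_num) h2
      omega
    refine ⟨hww, ?_, ?_⟩
    · rintro ⟨y, hy⟩
      refine h12.resolve_right fun h2' => hy ?_
      refine (iso_dvd hg hgv 2).1 (fun y => ?_) y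
      have := hdiv y
      rwa [h2', h.symm] at this
    · intro hy
      refine h12.resolve_left fun h1 => ?_
      have := (iso_dvd hg hgv 2).2 hy f
      rw [h.symm, h1] at this
      omega
  obtain ⟨k1, k2, k3⟩ := key v w hv hw hp hdiv
  obtain ⟨k1', k2', k3'⟩ := key v' w' hv' hw' hp' hdiv'
  suffices ERel B w w' from (hw.trans this).iso.trans hw'.iso.symm
  rcases hd with ⟨d1, d2⟩ | ⟨d1, d2, z, hz⟩
  · refine same_class h H.ff w w' (w' - w) (by omega) ?_ (by rw [k2 d1, k2' d2]) (by omega)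
    rw [k2 d1]; simp
  · obtain ⟨_, _, _, g⟩ := hw
    obtain ⟨_, _, _, g'⟩ := hw'
    obtain ⟨z1, hz1⟩ := g d1
    obtain ⟨z2, hz2⟩ := g' d2
    refine same_class h H.ff w w' (z2 + z - z1) (by omega) ?_ (by rw [k3 d1, k3' d2]) (by omega)
    rw [k3 d1, smul_sub, smul_add, ← hz1, ← hz2, ← hz]; abel

end Eichler

/-- the bilinear form of `T` -/
def Bt (x y : Fin 17 → ℤ) : ℤ := x ⬝ᵥ gramT.mulVec y

/-- upper triangular half of the Gram matrix -/
def halfT : Matrix (Fin 17) (Fin 17) ℤ :=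
  Matrix.of fun i j => if i = j then gramT i j / 2 else if i < j then gramT i j else 0

theorem halfT_add : halfT + halfTᵀ = gramT := by decide +kernel

theorem gramT_symm : gramTᵀ = gramT := by decide +kernel

theorem evenT : EvenForm Bt (fun x => x ⬝ᵥ halfT.mulVec x) where
  symm x y := by
    unfold Bt
    rw [dotProduct_mulVec, ← mulVec_transpose, gramT_symm, dotProduct_comm]
  add x y z := by simp [Bt, mulVec_add, dotProduct_add]
  smul x n y := by rw [Bt, mulVec_smul, dotProduct_smul]; rfl
  even x := by
    unfold Bt
    rw [← halfT_add, add_mulVec, dotProduct_add, mulVec_transpose,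
      dotProduct_comm x (x ᵥ* halfT), ← dotProduct_mulVec]
    ring

theorem hypT : TwoHyp Bt eU fU (Pi.single 2 1) (Pi.single 3 1) := by
  constructor <;> decide +kernel

theorem orb_iff (v r : Fin 17 → ℤ) : OrbEquiv v r ↔ IsoRel Bt v r := by
  constructor
  · rintro ⟨P, ⟨h1, h2⟩, h3⟩
    refine ⟨Matrix.toLinearEquiv' P (Matrix.invertibleOfIsUnitDet P h1), fun x y => ?_, ?_⟩
    · change (P *ᵥ x) ⬝ᵥ (gramT *ᵥ (P *ᵥ y)) = x ⬝ᵥ (gramT *ᵥ y)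
      conv_rhs => rw [← h2]
      rw [← mulVec_mulVec, ← mulVec_mulVec, dotProduct_mulVec x, vecMul_transpose]
    · exact h3
  · rintro ⟨f, hf, hv⟩
    have hap : ∀ x, (LinearMap.toMatrix' (f : (Fin 17 → ℤ) →ₗ[ℤ] (Fin 17 → ℤ))) *ᵥ x = f x := by
      intro x
      rw [LinearMap.toMatrix'_mulVec]; rfl
    set P := LinearMap.toMatrix' (f : (Fin 17 → ℤ) →ₗ[ℤ] (Fin 17 → ℤ)) with hP
    refine ⟨P, ⟨?_, ?_⟩, by rw [hap, hv]⟩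
    · rw [hP, LinearMap.det_toMatrix']
      exact LinearEquiv.isUnit_det' f
    · ext i j
      have := hf (Pi.single i 1) (Pi.single j 1)
      rw [← hap, ← hap] at this
      unfold Bt at this
      rw [← vecMul_transpose, ← dotProduct_mulVec, mulVec_mulVec, mulVec_mulVec] at this
      simpa using this

theorem dvd_iff (r : Fin 17 → ℤ) : (∀ i, (2 : ℤ) ∣ gramT.mulVec r i) ↔ ∀ y, 2 ∣ Bt r y := by
  constructor
  · intro h y
    rw [evenT.symm, Bt, dotProduct]
    exact Finset.dvd_sum fun i _ => (h i).mul_left _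
  · intro h i
    have := h (Pi.single i 1)
    rw [evenT.symm] at this
    simpa [Bt] using this

theorem two_smul_iff (x : Fin 17 → ℤ) : (∀ i, (2 : ℤ) ∣ x i) ↔ ∃ z, x = (2 : ℤ) • z := by
  constructor
  · intro h
    choose z hz using h
    exact ⟨z, funext hz⟩
  · rintro ⟨z, rfl⟩ i
    exact ⟨z i, rfl⟩

/-- the sum of the `rₖ` with coefficients -/
def sV (c : Fin 5 → ℤ) : Fin 17 → ℤ := ∑ k, c k • rA k

/-- scaled inverse of the Gram matrix on the unimodular part -/
def invT : Matrix (Fin 17) (Fin 17) ℤ :=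
  blockSum gramU (blockSum gramU (blockSum
    !![-4, -7, -10, -8, -6, -4, -2, -5;
      -7, -14, -20, -16, -12, -8, -4, -10;
      -10, -20, -30, -24, -18, -12, -6, -15;
      -8, -16, -24, -20, -15, -10, -5, -12;
      -6, -12, -18, -15, -12, -8, -4, -9;
      -4, -8, -12, -10, -8, -6, -3, -6;
      -2, -4, -6, -5, -4, -3, -2, -3;
      -5, -10, -15, -12, -9, -6, -3, -8]
    (Matrix.diagonal fun _ : Fin 5 => (-1 : ℤ))))

theorem invT_mul : invT * gramT = Matrix.diagonal fun i => if i < 12 then 1 else 2 := by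
  decide +kernel

theorem even_coords (r : Fin 17 → ℤ) (h : ∀ i, (2 : ℤ) ∣ gramT.mulVec r i) (i : Fin 17)
    (hi : i < 12) : 2 ∣ r i := by
  have h1 : (invT *ᵥ (gramT *ᵥ r)) i = r i := by
    rw [mulVec_mulVec, invT_mul, mulVec_diagonal]
    simp [hi]
  rw [← h1, mulVec, dotProduct]
  exact Finset.dvd_sum fun j _ => (h j).mul_left _

theorem sV_low (c : Fin 5 → ℤ) (i : Fin 17) (hi : i < 12) : sV c i = 0 := by
  simp only [sV, Finset.sum_apply, Pi.smul_apply, rA, smul_eq_mul]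
  refine Finset.sum_eq_zero fun k _ => ?_
  rw [Pi.single_eq_of_ne, mul_zero]
  intro h
  rw [h] at hi
  have := Fin.lt_def.1 hi
  simp at this

theorem sV_high (c : Fin 5 → ℤ) (k : Fin 5) : sV c ⟨12 + (k : ℕ), by have := k.isLt; omega⟩ = c k := by
  simp only [sV, Finset.sum_apply, Pi.smul_apply, rA, smul_eq_mul]
  rw [Finset.sum_eq_single k]
  · simp
  · intro b _ hb
    rw [Pi.single_eq_of_ne, mul_zero]
    intro h
    rw [Fin.mk.injEq] at h
    exact hb (Fin.ext (by omega))
  · simp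

theorem fin_cover (i : Fin 17) : i < 12 ∨ ∃ k : Fin 5, i = ⟨12 + (k : ℕ), by have := k.isLt; omega⟩ := by
  revert i; decide

theorem Bt_rA (x : Fin 17 → ℤ) (k : Fin 5) :
    Bt x (rA k) = -2 * x ⟨12 + (k : ℕ), by have := k.isLt; omega⟩ := by
  have h : gramT *ᵥ (rA k) = (-2 : ℤ) • rA k := by revert k; decide +kernel
  unfold Bt
  rw [h, dotProduct_smul, rA, dotProduct_single]
  simp

theorem Bt_sV (x : Fin 17 → ℤ) (c : Fin 5 → ℤ) :
    Bt x (sV c) = -2 * ∑ k : Fin 5, c k * x ⟨12 + (k : ℕ), by have := k.isLt; omega⟩ := by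
  have h : ∀ k, Bt x (c k • rA k) = c k * Bt x (rA k) := fun k => evenT.smul _ _ _
  have h2 : Bt x (sV c) = ∑ k, Bt x (c k • rA k) := by
    simp only [sV, Bt, mulVec_sum, dotProduct_sum]
  rw [h2, Finset.mul_sum]
  refine Finset.sum_congr rfl fun k _ => ?_
  rw [h, Bt_rA]; ring

/-- a vector with even divisor is congruent mod 2 to its parity vector -/
theorem class_exists (r : Fin 17 → ℤ) (h : ∀ i, (2 : ℤ) ∣ gramT.mulVec r i) :
    ∃ c : Fin 5 → ℤ, (∀ k, c k = 0 ∨ c k = 1) ∧ ∃ z, r = sV c + (2 : ℤ) • z := by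
  refine ⟨fun k => r ⟨12 + (k : ℕ), by have := k.isLt; omega⟩ % 2, fun k => by dsimp only; omega, ?_⟩
  obtain ⟨z, hz⟩ := (two_smul_iff (r - sV fun k => r ⟨12 + (k : ℕ), by have := k.isLt; omega⟩ % 2)).1
    (by
      intro i
      rcases fin_cover i with hi | ⟨k, rfl⟩
      · rw [Pi.sub_apply, sV_low _ _ hi, sub_zero]
        exact even_coords r h i hi
      · rw [Pi.sub_apply, sV_high]
        omega)
  exact ⟨z, by rw [← hz]; abel⟩

theorem sV_one : sV (fun _ => 1) = ∑ k : Fin 5, rA k := by simp [sV]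

theorem sV_single (k : Fin 5) : sV (Pi.single k 1) = rA k := by
  revert k; decide +kernel

theorem trichotomy (r : Fin 17 → ℤ) (hr : Bt r r = -2) (h : ∀ i, (2 : ℤ) ∣ gramT.mulVec r i) :
    (∀ i, (2 : ℤ) ∣ (r - ∑ k : Fin 5, rA k) i) ∨ ∃ k : Fin 5, ∀ i, (2 : ℤ) ∣ (r - rA k) i := by
  obtain ⟨c, hc, z, rfl⟩ := class_exists r h
  rw [evenT.add, evenT.smul, evenT.add', evenT.add', evenT.smul', evenT.smul', evenT.even z,
    evenT.symm (sV c) z, Bt_sV, Bt_sV] at hr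
  simp only [sV_high] at hr
  generalize (∑ k : Fin 5, c k * z ⟨12 + (k : ℕ), by have := k.isLt; omega⟩) = t at hr
  generalize z ⬝ᵥ halfT.mulVec z = s at hr
  have hmod : (∑ k, c k * c k) % 4 = 1 := by omega
  have hcase : c = (fun _ => 1) ∨ ∃ k, c = Pi.single k 1 := by
    have hb : ∃ b : Fin 5 → Bool, c = fun k => if b k then 1 else 0 := by
      refine ⟨fun k => decide (c k = 1), funext fun k => ?_⟩
      rcases hc k with h | h <;> simp [h]
    obtain ⟨b, rfl⟩ := hb
    clear hr hc h
    revert b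
    decide +kernel
  rcases hcase with rfl | ⟨k, rfl⟩
  · left
    rw [two_smul_iff]
    exact ⟨z, by rw [sV_one]; abel⟩
  · right
    refine ⟨k, ?_⟩
    rw [two_smul_iff]
    exact ⟨z, by rw [sV_single]; abel⟩

/-- the half of the vector is a characteristic element of the discriminant form -/
def CharT (r : Fin 17 → ℤ) : Prop :=
  ∀ y, (∀ x, 2 ∣ Bt y x) → 4 ∣ Bt y y - Bt y r

theorem CharT_iso {v r : Fin 17 → ℤ} (h : IsoRel Bt v r) (hv : CharT v) : CharT r := by
  obtain ⟨f, hf, rfl⟩ := h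
  intro y hy
  have h1 := hv (f.symm y) (fun x => by
    rw [← hf, LinearEquiv.apply_symm_apply]; exact hy _)
  rw [← hf, ← hf _ v, LinearEquiv.apply_symm_apply] at h1
  exact h1

theorem CharT_of_all {r : Fin 17 → ℤ} (h : ∀ i, (2 : ℤ) ∣ (r - ∑ k : Fin 5, rA k) i) :
    CharT r := by
  intro y hy
  obtain ⟨z, hz⟩ := (two_smul_iff _).1 h
  obtain rfl : r = sV (fun _ => 1) + (2 : ℤ) • z := by rw [sV_one, ← hz]; abel
  obtain ⟨c, hc, z', rfl⟩ := class_exists y ((dvd_iff y).2 hy)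
  have hz2 := hy z
  have hz3 := hy z'
  rw [evenT.add, evenT.add _ (sV fun _ => 1), evenT.smul, evenT.smul, Bt_sV, Bt_sV]
  obtain ⟨s, hs⟩ := hz2
  obtain ⟨t, ht⟩ := hz3
  rw [hs, ht]
  have : ∀ k : Fin 5, (sV c + (2 : ℤ) • z') ⟨12 + (k : ℕ), by have := k.isLt; omega⟩ =
      c k + 2 * z' ⟨12 + (k : ℕ), by have := k.isLt; omega⟩ := fun k => by
    rw [Pi.add_apply, sV_high]; rfl
  simp only [this]
  have h2 : (2 : ℤ) ∣ (∑ k : Fin 5, c k * (c k + 2 * z' ⟨12 + (k : ℕ), by have := k.isLt; omega⟩)) -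
     ∑ k : Fin 5, 1 * (c k + 2 * z' ⟨12 + (k : ℕ), by have := k.isLt; omega⟩) := by
    rw [← Finset.sum_sub_distrib]
    refine Finset.dvd_sum fun k _ => ?_
    rcases hc k with h | h <;> rw [h]
    · exact ⟨-z' ⟨12 + (k : ℕ), by have := k.isLt; omega⟩, by ring⟩
    · simp
  omega

theorem not_CharT {r : Fin 17 → ℤ} (k : Fin 5) (h : ∀ i, (2 : ℤ) ∣ (r - rA k) i) :
    ¬ CharT r := by
  intro hc
  obtain ⟨j, hj⟩ : ∃ j : Fin 5, j ≠ k := exists_ne k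
  have h1 := hc (rA j) (fun x => by
    rw [evenT.symm, Bt_rA]; exact ⟨-x ⟨12 + (j : ℕ), by have := j.isLt; omega⟩, by ring⟩)
  rw [evenT.symm _ r, Bt_rA, Bt_rA] at h1
  have h2 := h ⟨12 + (j : ℕ), by have := j.isLt; omega⟩
  have h3 : rA j ⟨12 + (j : ℕ), by have := j.isLt; omega⟩ = 1 := by simp [rA]
  have h4 : rA k ⟨12 + (j : ℕ), by have := j.isLt; omega⟩ = 0 := by
    rw [rA, Pi.single_eq_of_ne]
    intro h
    rw [Fin.mk.injEq] at h
    exact hj (Fin.ext (by omega))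
  rw [Pi.sub_apply, h4] at h2
  rw [h3] at h1
  omega

theorem perm_iso (k : Fin 5) : IsoRel Bt (rA 0) (rA k) := by
  set σ : Equiv.Perm (Fin 17) := Equiv.swap 12 ⟨12 + (k : ℕ), by have := k.isLt; omega⟩ with hσ
  have hG : ∀ i j, gramT (σ i) (σ j) = gramT i j := by
    have hs : gramT.submatrix σ σ = gramT := by
      rw [hσ]; clear hσ σ; revert k; decide +kernel
    exact fun i j => congrFun (congrFun hs i) j
  refine ⟨LinearEquiv.funCongrLeft ℤ ℤ σ, fun x y => ?_, ?_⟩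
  · simp only [Bt, dotProduct, mulVec, LinearEquiv.funCongrLeft_apply, LinearMap.funLeft_apply]
    rw [← Equiv.sum_comp σ (fun i => x i * ∑ j, gramT i j * y j)]
    refine Finset.sum_congr rfl fun i _ => ?_
    rw [← Equiv.sum_comp σ (fun j => gramT (σ i) j * y j)]
    simp only [hG]
  · rw [hσ]; clear hG hσ σ
    funext i
    simp only [LinearEquiv.funCongrLeft_apply, LinearMap.funLeft_apply]
    revert i k
    decide +kernel

theorem d1_orb (r : Fin 17 → ℤ) (hr : Bt r r = -2) (h : ¬ ∀ i, (2 : ℤ) ∣ gramT.mulVec r i) :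
    IsoRel Bt (eU - fU) r := by
  refine eichler_root evenT hypT _ _ (by decide +kernel) hr (Or.inl ⟨⟨fU, by decide +kernel⟩, ?_⟩)
  rw [dvd_iff] at h
  push Not at h
  exact h

theorem d2_orb (r : Fin 17 → ℤ) (hr : Bt r r = -2) (h : ∀ i, (2 : ℤ) ∣ gramT.mulVec r i)
    (h2 : ∀ i, (2 : ℤ) ∣ (r - ∑ k : Fin 5, rA k) i) :
    IsoRel Bt (2 • (eU + fU) + ∑ k : Fin 5, rA k) r := by
  refine eichler_root evenT hypT _ _ (by decide +kernel) hr (Or.inr ⟨?_, ?_, ?_⟩)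
  · rw [← dvd_iff]; decide +kernel
  · rwa [← dvd_iff]
  · obtain ⟨z, hz⟩ := (two_smul_iff _).1 h2
    refine ⟨z - (eU + fU), ?_⟩
    rw [smul_sub, ← hz]
    module

theorem d3_orb (r : Fin 17 → ℤ) (hr : Bt r r = -2) (h : ∀ i, (2 : ℤ) ∣ gramT.mulVec r i)
    (k : Fin 5) (h2 : ∀ i, (2 : ℤ) ∣ (r - rA k) i) : IsoRel Bt (rA 0) r := by
  refine (perm_iso k).trans ?_
  refine eichler_root evenT hypT _ _ (by clear h2; revert k; decide +kernel) hr (Or.inr ⟨?_, ?_, ?_⟩)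
  · rw [← dvd_iff]; clear h2; revert k; decide +kernel
  · rwa [← dvd_iff]
  · exact (two_smul_iff _).1 h2

theorem dvd_iso {v r : Fin 17 → ℤ} (h : IsoRel Bt v r) :
    (∀ i, (2 : ℤ) ∣ gramT.mulVec r i) ↔ (∀ i, (2 : ℤ) ∣ gramT.mulVec v i) := by
  obtain ⟨f, hf, hv⟩ := h
  rw [dvd_iff, dvd_iff]
  exact iso_dvd hf hv 2

/-- `O(T)` has exactly three orbits on `Δ = {r : B(r,r) = -2}`, with representatives
`e - f`, `r₁` and `2(e+f) + r₁ + ⋯ + r₅`; the orbits are `Δ₁ = {r : Gr ∉ 2ℤ¹⁷}`,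
`Δ₂ = {r : Gr ∈ 2ℤ¹⁷, [r/2] = [(r₁+⋯+r₅)/2] in T*/T}` and
`Δ₃ = {r : Gr ∈ 2ℤ¹⁷, [r/2] = [rᵢ/2] for some i}`. -/
theorem OT_orbits_on_roots (r : Fin 17 → ℤ) (hr : r ⬝ᵥ gramT.mulVec r = -2) :
    (∃! k : Fin 3, OrbEquiv (reps k) r) ∧
    (OrbEquiv (eU - fU) r ↔ ¬ ∀ i, (2 : ℤ) ∣ gramT.mulVec r i) ∧
    (OrbEquiv (2 • (eU + fU) + ∑ k : Fin 5, rA k) r ↔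
      (∀ i, (2 : ℤ) ∣ gramT.mulVec r i) ∧ ∀ i, (2 : ℤ) ∣ (r - ∑ k : Fin 5, rA k) i) ∧
    (OrbEquiv (rA 0) r ↔
      (∀ i, (2 : ℤ) ∣ gramT.mulVec r i) ∧ ∃ k : Fin 5, ∀ i, (2 : ℤ) ∣ (r - rA k) i) := by
  have hr' : Bt r r = -2 := hr
  have i1 : OrbEquiv (eU - fU) r ↔ ¬ ∀ i, (2 : ℤ) ∣ gramT.mulVec r i := by
    rw [orb_iff]
    refine ⟨fun h => ?_, d1_orb r hr'⟩
    rw [dvd_iso h]; decide +kernel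
  have i2 : OrbEquiv (2 • (eU + fU) + ∑ k : Fin 5, rA k) r ↔
      (∀ i, (2 : ℤ) ∣ gramT.mulVec r i) ∧ ∀ i, (2 : ℤ) ∣ (r - ∑ k : Fin 5, rA k) i := by
    rw [orb_iff]
    refine ⟨fun h => ?_, fun h => d2_orb r hr' h.1 h.2⟩
    have h1 := (dvd_iso h).2 (by decide +kernel)
    refine ⟨h1, (trichotomy r hr' h1).resolve_right ?_⟩
    rintro ⟨k, hk⟩
    exact not_CharT k hk (CharT_iso h (CharT_of_all (by decide +kernel)))
  have i3 : OrbEquiv (rA 0) r ↔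
      (∀ i, (2 : ℤ) ∣ gramT.mulVec r i) ∧ ∃ k : Fin 5, ∀ i, (2 : ℤ) ∣ (r - rA k) i := by
    rw [orb_iff]
    refine ⟨fun h => ?_, fun h => ?_⟩
    · have h1 := (dvd_iso h).2 (by decide +kernel)
      refine ⟨h1, (trichotomy r hr' h1).resolve_left fun h2 => ?_⟩
      exact not_CharT 0 (by decide +kernel) (CharT_iso h.symm (CharT_of_all h2))
    · obtain ⟨h1, k, hk⟩ := h
      exact d3_orb r hr' h1 k hk
  have hdisj : ∀ k : Fin 5, (∀ i, (2 : ℤ) ∣ (r - rA k) i) →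
      ¬ ∀ i, (2 : ℤ) ∣ (r - ∑ k : Fin 5, rA k) i :=
    fun k hk h => not_CharT k hk (CharT_of_all h)
  refine ⟨?_, i1, i2, i3⟩
  have j0 : OrbEquiv (reps 0) r ↔ ¬ ∀ i, (2 : ℤ) ∣ gramT.mulVec r i := i1
  have j1 : OrbEquiv (reps 1) r ↔
      (∀ i, (2 : ℤ) ∣ gramT.mulVec r i) ∧ ∃ k : Fin 5, ∀ i, (2 : ℤ) ∣ (r - rA k) i := i3
  have j2 : OrbEquiv (reps 2) r ↔
      (∀ i, (2 : ℤ) ∣ gramT.mulVec r i) ∧ ∀ i, (2 : ℤ) ∣ (r - ∑ k : Fin 5, rA k) i := i2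
  have huniq : ∀ k l : Fin 3, OrbEquiv (reps k) r → OrbEquiv (reps l) r → l = k := by
    intro k l hk hl
    fin_cases k <;> fin_cases l <;> first | rfl | exfalso
    · exact (j0.1 hk) (j1.1 hl).1
    · exact (j0.1 hk) (j2.1 hl).1
    · exact (j0.1 hl) (j1.1 hk).1
    · obtain ⟨_, k, hk⟩ := j1.1 hk
      exact hdisj k hk (j2.1 hl).2
    · exact (j0.1 hl) (j2.1 hk).1
    · obtain ⟨_, k, hk'⟩ := j1.1 hl
      exact hdisj k hk' (j2.1 hk).2
  by_cases h : ∀ i, (2 : ℤ) ∣ gramT.mulVec r i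
  · rcases trichotomy r hr' h with h2 | h2
    · exact ⟨2, j2.2 ⟨h, h2⟩, fun l hl => huniq 2 l (j2.2 ⟨h, h2⟩) hl⟩
    · exact ⟨1, j1.2 ⟨h, h2⟩, fun l hl => huniq 1 l (j1.2 ⟨h, h2⟩) hl⟩
  · exact ⟨0, j0.2 h, fun l hl => huniq 0 l (j0.2 h) hl⟩
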